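/- For every q ∈ ℝ, the function F_q(x¹,x²) = q·((x¹)² + (x²)²)·arctan(x¹/x²) − (1/8)·((x¹)² + (x²)²)·log((x¹)² + (x²)²), defined on the open set {(x¹,x²) ∈ ℝ² : x² ≠ 0}, satisfies the associativity equations with respect to η = identity: for all α, β, γ, δ ∈ {1,2} and all points of the domain, Σ_{λ=1}^{2} (∂³F_q/∂x^α∂x^β∂x^λ)(∂³F_q/∂x^γ∂x^δ∂x^λ) = Σ_{λ=1}^{2} (∂³F_q/∂x^γ∂x^β∂x^λ)(∂³F_q/∂x^α∂x^δ∂x^λ). -/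

import Mathlib

/-- The partial derivative `∂f/∂x^i` at `x`, for `f : ℝ² → ℝ`. -/
noncomputable def pd (f : (Fin 2 → ℝ) → ℝ) (i : Fin 2) (x : Fin 2 → ℝ) : ℝ :=
  fderiv ℝ f x (Pi.single i 1)

/-- The third partial derivative `∂³f/∂x^a∂x^b∂x^c` at `x`. -/
noncomputable def thd (f : (Fin 2 → ℝ) → ℝ) (a b c : Fin 2) (x : Fin 2 → ℝ) : ℝ :=
  pd (pd (pd f c) b) a x

/-- The prepotential
`F_q(x¹,x²) = q·((x¹)²+(x²)²)·arctan(x¹/x²) − (1/8)·((x¹)²+(x²)²)·log((x¹)²+(x²)²)`. -/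
noncomputable def Fq (q : ℝ) : (Fin 2 → ℝ) → ℝ := fun x =>
  q * ((x 0) ^ 2 + (x 1) ^ 2) * Real.arctan (x 0 / x 1) -
    (1 / 8) * ((x 0) ^ 2 + (x 1) ^ 2) * Real.log ((x 0) ^ 2 + (x 1) ^ 2)

/-- A partial derivative may be read off from any Fréchet derivative. -/
theorem HasFDerivAt.pd_eq {f : (Fin 2 → ℝ) → ℝ} {f' : (Fin 2 → ℝ) →L[ℝ] ℝ} {x : Fin 2 → ℝ}
    (h : HasFDerivAt f f' x) (i : Fin 2) : pd f i x = f' (Pi.single i 1) := by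
  rw [pd, h.fderiv]

/-- Partial derivatives depend only on the germ of the function. -/
theorem Filter.EventuallyEq.pd_eq {f g : (Fin 2 → ℝ) → ℝ} {x : Fin 2 → ℝ}
    (h : f =ᶠ[nhds x] g) (i : Fin 2) : pd f i x = pd g i x := by
  rw [pd, pd, h.fderiv_eq]

theorem eventually_apply_one_ne_zero {x : Fin 2 → ℝ} (hx : x 1 ≠ 0) :
    ∀ᶠ y in nhds x, y 1 ≠ 0 :=
  (continuous_apply (1 : Fin 2)).continuousAt.eventually_ne hx

theorem sq_add_sq_ne_zero {x : Fin 2 → ℝ} (hx : x 1 ≠ 0) : x 0 ^ 2 + x 1 ^ 2 ≠ 0 := by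
  positivity

theorem hasFDerivAt_coord (i : Fin 2) (x : Fin 2 → ℝ) :
    HasFDerivAt (fun y : Fin 2 → ℝ => y i) (ContinuousLinearMap.proj (R := ℝ) i) x :=
  hasFDerivAt_apply i x

theorem hasFDerivAt_sq_add_sq (x : Fin 2 → ℝ) :
    HasFDerivAt (fun y : Fin 2 → ℝ => y 0 ^ 2 + y 1 ^ 2)
      ((2 * x 0) • ContinuousLinearMap.proj (R := ℝ) (φ := fun _ : Fin 2 => ℝ) 0 +
        (2 * x 1) • ContinuousLinearMap.proj (R := ℝ) (φ := fun _ : Fin 2 => ℝ) 1) x := by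
  refine (((hasFDerivAt_coord 0 x).pow 2).add ((hasFDerivAt_coord 1 x).pow 2)).congr_fderiv ?_
  simp

theorem hasFDerivAt_inv_sq_add_sq {x : Fin 2 → ℝ} (hx : x 1 ≠ 0) :
    HasFDerivAt (fun y : Fin 2 → ℝ => (y 0 ^ 2 + y 1 ^ 2)⁻¹)
      (-((x 0 ^ 2 + x 1 ^ 2) ^ 2)⁻¹ •
        ((2 * x 0) • ContinuousLinearMap.proj (R := ℝ) (φ := fun _ : Fin 2 => ℝ) 0 +
        (2 * x 1) • ContinuousLinearMap.proj (R := ℝ) (φ := fun _ : Fin 2 => ℝ) 1)) x :=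
  (hasDerivAt_inv (sq_add_sq_ne_zero hx)).comp_hasFDerivAt x (hasFDerivAt_sq_add_sq x)

theorem hasFDerivAt_log_sq_add_sq {x : Fin 2 → ℝ} (hx : x 1 ≠ 0) :
    HasFDerivAt (fun y : Fin 2 → ℝ => Real.log (y 0 ^ 2 + y 1 ^ 2))
      ((x 0 ^ 2 + x 1 ^ 2)⁻¹ •
        ((2 * x 0) • ContinuousLinearMap.proj (R := ℝ) (φ := fun _ : Fin 2 => ℝ) 0 +
        (2 * x 1) • ContinuousLinearMap.proj (R := ℝ) (φ := fun _ : Fin 2 => ℝ) 1)) x :=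
  (hasFDerivAt_sq_add_sq x).log (sq_add_sq_ne_zero hx)

theorem hasFDerivAt_arctan_div {x : Fin 2 → ℝ} (hx : x 1 ≠ 0) :
    HasFDerivAt (fun y : Fin 2 → ℝ => Real.arctan (y 0 / y 1))
      ((x 0 ^ 2 + x 1 ^ 2)⁻¹ •
        (x 1 • ContinuousLinearMap.proj (R := ℝ) (φ := fun _ : Fin 2 => ℝ) 0 -
        x 0 • ContinuousLinearMap.proj (R := ℝ) (φ := fun _ : Fin 2 => ℝ) 1)) x := by
  have hr := sq_add_sq_ne_zero hx
  have h := (((hasFDerivAt_coord 0 x).mul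
    ((hasDerivAt_inv hx).comp_hasFDerivAt x (hasFDerivAt_coord 1 x))).arctan)
  simp only [div_eq_mul_inv]
  refine h.congr_fderiv (ContinuousLinearMap.ext fun v => ?_)
  simp
  field_simp
  ring

/-- The first partial derivatives of `Fq q` on `{x 1 ≠ 0}`. -/
noncomputable def firstFq (q : ℝ) (i : Fin 2) (x : Fin 2 → ℝ) : ℝ :=
  2 * q * (x i * Real.arctan (x 0 / x 1)) + q * ![x 1, -x 0] i -
    1 / 4 * (x i * Real.log (x 0 ^ 2 + x 1 ^ 2)) - 1 / 4 * x i

/-- The second partial derivatives of `Fq q` on `{x 1 ≠ 0}`. -/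
noncomputable def secondFq (q : ℝ) : Fin 2 → Fin 2 → (Fin 2 → ℝ) → ℝ :=
  ![![fun x => 2 * q * Real.arctan (x 0 / x 1) - 1 / 4 * Real.log (x 0 ^ 2 + x 1 ^ 2) +
        (2 * q * (x 0 * x 1) - 1 / 2 * x 0 ^ 2) * (x 0 ^ 2 + x 1 ^ 2)⁻¹ - 1 / 4,
      fun x => (q * (x 1 ^ 2 - x 0 ^ 2) - 1 / 2 * (x 0 * x 1)) * (x 0 ^ 2 + x 1 ^ 2)⁻¹],
    ![fun x => (q * (x 1 ^ 2 - x 0 ^ 2) - 1 / 2 * (x 0 * x 1)) * (x 0 ^ 2 + x 1 ^ 2)⁻¹,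
      fun x => 2 * q * Real.arctan (x 0 / x 1) - 1 / 4 * Real.log (x 0 ^ 2 + x 1 ^ 2) -
        (2 * q * (x 0 * x 1) + 1 / 2 * x 1 ^ 2) * (x 0 ^ 2 + x 1 ^ 2)⁻¹ - 1 / 4]]

/-- The third partial derivatives of `Fq q` on `{x 1 ≠ 0}`, indexed by the number of
differentiations in the second variable. -/
noncomputable def thirdFq (q : ℝ) (a b c : Fin 2) (x : Fin 2 → ℝ) : ℝ :=
  ![(4 * q * x 1 ^ 3 - x 0 ^ 3 / 2 - 3 / 2 * (x 0 * x 1 ^ 2)) / (x 0 ^ 2 + x 1 ^ 2) ^ 2,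
    (-4 * q * (x 0 * x 1 ^ 2) + x 0 ^ 2 * x 1 / 2 - x 1 ^ 3 / 2) / (x 0 ^ 2 + x 1 ^ 2) ^ 2,
    (4 * q * (x 0 ^ 2 * x 1) - x 0 ^ 3 / 2 + x 0 * x 1 ^ 2 / 2) / (x 0 ^ 2 + x 1 ^ 2) ^ 2,
    (-4 * q * x 0 ^ 3 - x 1 ^ 3 / 2 - 3 / 2 * (x 0 ^ 2 * x 1)) / (x 0 ^ 2 + x 1 ^ 2) ^ 2]
    ⟨a + b + c, by omega⟩

theorem pd_Fq (q : ℝ) {x : Fin 2 → ℝ} (hx : x 1 ≠ 0) (i : Fin 2) :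
    pd (Fq q) i x = firstFq q i x := by
  have hr := sq_add_sq_ne_zero hx
  have h : HasFDerivAt (Fq q) _ x :=
    (((hasFDerivAt_sq_add_sq x).const_mul q).mul (hasFDerivAt_arctan_div hx)).sub
      (((hasFDerivAt_sq_add_sq x).const_mul (1 / 8)).mul (hasFDerivAt_log_sq_add_sq hx))
  rw [h.pd_eq]
  fin_cases i <;> simp [firstFq] <;> field_simp <;> ring

theorem pd_firstFq (q : ℝ) {x : Fin 2 → ℝ} (hx : x 1 ≠ 0) (i j : Fin 2) :
    pd (firstFq q j) i x = secondFq q i j x := by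
  have hr := sq_add_sq_ne_zero hx
  have key (k : Fin 2) (e : ℝ) := ((((((hasFDerivAt_coord j x).mul
    (hasFDerivAt_arctan_div hx)).const_mul (2 * q)).add
      (((hasFDerivAt_coord k x).const_mul e).const_mul q)).sub
    (((hasFDerivAt_coord j x).mul (hasFDerivAt_log_sq_add_sq hx)).const_mul (1 / 4))).sub
    ((hasFDerivAt_coord j x).const_mul (1 / 4)))
  fin_cases j
  · have h : HasFDerivAt (firstFq q 0) _ x :=
      (key 1 1).congr_of_eventuallyEq (.of_forall fun y => by simp [firstFq])
    simp only [Fin.zero_eta, h.pd_eq]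
    fin_cases i <;> simp [secondFq] <;> field_simp <;> ring
  · have h : HasFDerivAt (firstFq q 1) _ x :=
      (key 0 (-1)).congr_of_eventuallyEq (.of_forall fun y => by simp [firstFq])
    simp only [Fin.mk_one, h.pd_eq]
    fin_cases i <;> simp [secondFq] <;> field_simp <;> ring

theorem pd_secondFq (q : ℝ) {x : Fin 2 → ℝ} (hx : x 1 ≠ 0) (i j k : Fin 2) :
    pd (secondFq q j k) i x = thirdFq q i j k x := by
  have hr := sq_add_sq_ne_zero hx
  have h0 := hasFDerivAt_coord 0 x
  have h1 := hasFDerivAt_coord 1 x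
  have hI := hasFDerivAt_inv_sq_add_sq hx
  have hAL := ((hasFDerivAt_arctan_div hx).const_mul (2 * q)).sub
    ((hasFDerivAt_log_sq_add_sq hx).const_mul (1 / 4))
  have h00 : HasFDerivAt (secondFq q 0 0) _ x :=
    (hAL.add ((((h0.mul h1).const_mul (2 * q)).sub ((h0.pow 2).const_mul (1 / 2))).mul
      hI)).sub_const (1 / 4)
  have h01 : HasFDerivAt (secondFq q 0 1) _ x :=
    ((((h1.pow 2).sub (h0.pow 2)).const_mul q).sub ((h0.mul h1).const_mul (1 / 2))).mul hI
  have h10 : HasFDerivAt (secondFq q 1 0) _ x := h01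
  have h11 : HasFDerivAt (secondFq q 1 1) _ x :=
    (hAL.sub ((((h0.mul h1).const_mul (2 * q)).add ((h1.pow 2).const_mul (1 / 2))).mul
      hI)).sub_const (1 / 4)
  fin_cases j <;> fin_cases k <;>
    simp only [Fin.zero_eta, Fin.mk_one, h00.pd_eq, h01.pd_eq, h10.pd_eq, h11.pd_eq] <;>
    fin_cases i <;> simp [thirdFq] <;> field_simp <;> ring

theorem thd_Fq (q : ℝ) {x : Fin 2 → ℝ} (hx : x 1 ≠ 0) (a b c : Fin 2) :
    thd (Fq q) a b c x = thirdFq q a b c x := by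
  have h {y : Fin 2 → ℝ} (hy : y 1 ≠ 0) : pd (pd (Fq q) c) b y = secondFq q b c y := by
    have hF : pd (Fq q) c =ᶠ[nhds y] firstFq q c :=
      (eventually_apply_one_ne_zero hy).mono fun z hz => pd_Fq q hz c
    rw [hF.pd_eq, pd_firstFq q hy]
  have hP : pd (pd (Fq q) c) b =ᶠ[nhds x] secondFq q b c :=
    (eventually_apply_one_ne_zero hx).mono fun y hy => h hy
  rw [thd, hP.pd_eq, pd_secondFq q hx]

/-- For every `q ∈ ℝ`, the prepotential `F_q` satisfies the
associativity (WDVV) equations with respect to the identity metric on the open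
set `{x² ≠ 0}`. -/
theorem Fq_satisfies_WDVV (q : ℝ) :
    ∀ α β γ δ : Fin 2, ∀ x : Fin 2 → ℝ, x 1 ≠ 0 →
      (∑ l, thd (Fq q) α β l x * thd (Fq q) γ δ l x) =
        ∑ l, thd (Fq q) γ β l x * thd (Fq q) α δ l x := by
  intro α β γ δ x hx
  have hr : x 0 ^ 2 + x 1 ^ 2 ≠ 0 := sq_add_sq_ne_zero hx
  fin_cases α <;> fin_cases β <;> fin_cases γ <;> fin_cases δ <;>
    simp [Fin.sum_univ_two, thd_Fq q hx, thirdFq] <;>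
    field_simp <;> ring
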